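/- arXiv:1507.04395 — 4 statements merged into one kernel-verified Lean document; each statement's English description precedes it below -/
import Mathlib

section
/- Let (X̄, d̄) be a compact metric space, Z ⊆ X̄ a closed subset, and X = X̄ \ Z. Let d be a metric on X which induces on X the subspace topology inherited from X̄ and is proper. Assume the Z-set condition and the control condition hold, and assume that for some n ∈ ℕ there exists a uniformly bounded open cover of (X, d) of order at most n + 1 (i.e., the Gromov macroscopic dimension of (X, d) is at most n). Then for every ε > 0 there exists an open cover 𝒱 of Z × [0,1], with the metric d∞, such that mesh(𝒱) < ε and the order of 𝒱 is at most n + 1 (so the covering dimension of Z × [0,1] is at most n). -/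
open Set Metric

/-- Piecewise linear interpolation of the first `N + 1` terms of a positive antitone sequence. -/
lemma exists_antitone_interpolation (t : ℕ → ℝ) (ht : Antitone t) (hpos : ∀ k, 0 < t k) (N : ℕ) :
    ∃ τ : ℝ → ℝ, Continuous τ ∧ Antitone τ ∧ (∀ s, 0 < τ s) ∧ (∀ s, τ s ≤ t 0) ∧
      ∀ k ≤ N, τ k = t k := by
  let τ : ℝ → ℝ := fun s =>
    t 0 - ∑ i ∈ Finset.range N, (t i - t (i + 1)) * max 0 (min 1 (s - i))
  have hstep (i : ℕ) : 0 ≤ t i - t (i + 1) := sub_nonneg.2 (ht i.le_succ)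
  refine ⟨τ, by fun_prop, fun a b hab => ?_, fun s => ?_, fun s => ?_, fun k hk => ?_⟩
  · refine sub_le_sub_left (Finset.sum_le_sum fun i _ => ?_) _
    have := hstep i
    gcongr
  · have hle : ∑ i ∈ Finset.range N, (t i - t (i + 1)) * max 0 (min 1 (s - i)) ≤
        ∑ i ∈ Finset.range N, (t i - t (i + 1)) :=
      Finset.sum_le_sum fun i _ => mul_le_of_le_one_right (hstep i) (by simp)
    rw [Finset.sum_range_sub'] at hle
    have := hpos N
    simp only [τ]
    linarith
  · exact sub_le_self _ (Finset.sum_nonneg fun i _ => mul_nonneg (hstep i) (le_max_left _ _))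
  · have hsum : ∑ i ∈ Finset.range N, (t i - t (i + 1)) * max 0 (min 1 ((k : ℝ) - i)) =
        ∑ i ∈ Finset.range k, (t i - t (i + 1)) := by
      rw [← Finset.sum_subset (Finset.range_mono hk)]
      · refine Finset.sum_congr rfl fun i hi => ?_
        have : (i : ℝ) + 1 ≤ k := by exact_mod_cast Finset.mem_range.1 hi
        rw [min_eq_left (by linarith), max_eq_right zero_le_one, mul_one]
      · intro i _ hi
        have : (k : ℝ) ≤ i := by exact_mod_cast not_lt.1 (fun h => hi (Finset.mem_range.2 h))
        rw [max_eq_left ((min_le_right _ _).trans (by linarith)), mul_zero]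
    simp only [τ]
    rw [hsum, Finset.sum_range_sub']
    ring

/-- Pulling back a cover of order at most `m` gives a cover of order at most `m`. -/
lemma order_preimage_cover_le {α β : Type*} (f : α → β) {𝒰 : Set (Set β)} {m : ℕ} (p : α)
    (h : {U | U ∈ 𝒰 ∧ f p ∈ U}.Finite ∧ {U | U ∈ 𝒰 ∧ f p ∈ U}.ncard ≤ m) :
    {V | V ∈ (fun U => f ⁻¹' U) '' 𝒰 ∧ p ∈ V}.Finite ∧
      {V | V ∈ (fun U => f ⁻¹' U) '' 𝒰 ∧ p ∈ V}.ncard ≤ m := by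
  have : {V | V ∈ (fun U => f ⁻¹' U) '' 𝒰 ∧ p ∈ V} =
      (fun U => f ⁻¹' U) '' {U | U ∈ 𝒰 ∧ f p ∈ U} := by
    ext V
    constructor
    · rintro ⟨⟨U, hU, rfl⟩, hp⟩
      exact ⟨U, ⟨hU, hp⟩, rfl⟩
    · rintro ⟨U, ⟨hU, hp⟩, rfl⟩
      exact ⟨⟨U, hU, rfl⟩, hp⟩
  rw [this]
  exact ⟨h.1.image _, (Set.ncard_image_le h.1).trans h.2⟩

/-- A homotopy starting at the identity is uniformly close to the identity for small times. -/
lemma exists_forall_dist_homotopy_lt {Y : Type*} [MetricSpace Y] [CompactSpace Y]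
    {H : Y × Icc (0 : ℝ) 1 → Y} (hH : Continuous H)
    (H_zero : ∀ (x : Y) (t : Icc (0 : ℝ) 1), (t : ℝ) = 0 → H (x, t) = x) {δ : ℝ} (hδ : 0 < δ) :
    ∃ t : ℝ, 0 < t ∧ t ≤ 1 ∧ ∀ (x : Y) (u : Icc (0 : ℝ) 1), (u : ℝ) ≤ t →
      dist (H (x, u)) x < δ := by
  have huc := CompactSpace.uniformContinuous_of_continuous hH
  obtain ⟨η, hη, h⟩ := Metric.uniformContinuous_iff.1 huc δ hδ
  refine ⟨min (η / 2) 1, by positivity, min_le_right _ _, fun x u hu => ?_⟩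
  have h0 := h (a := (x, u)) (b := (x, ⟨0, by simp⟩)) ?_
  · rwa [H_zero x ⟨0, by simp⟩ rfl] at h0
  · have : (u : ℝ) ≤ η / 2 := hu.trans (min_le_left _ _)
    rw [Prod.dist_eq, dist_self, Subtype.dist_eq, Real.dist_eq, sub_zero, abs_of_nonneg u.2.1]
    exact max_lt hη (by linarith)

/-- If every positive real is `r`-related to a smaller positive real, then there is a positive antitone
sequence with given initial term whose consecutive terms are `r`-related. -/
lemma exists_antitone_seq {r : ℝ → ℝ → Prop} {t₀ : ℝ} (h₀ : 0 < t₀)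
    (hr : ∀ t > 0, ∃ t', 0 < t' ∧ t' ≤ t ∧ r t t') :
    ∃ t : ℕ → ℝ, t 0 = t₀ ∧ Antitone t ∧ (∀ k, 0 < t k) ∧ ∀ k, r (t k) (t (k + 1)) := by
  choose! g hg hgle hgr using hr
  let t : ℕ → ℝ := fun k => g^[k] t₀
  have hsucc (k : ℕ) : t (k + 1) = g (t k) := Function.iterate_succ_apply' g k t₀
  have hpos (k : ℕ) : 0 < t k := by
    induction k with
    | zero => exact h₀
    | succ k ih => rw [hsucc]; exact hg _ ih
  refine ⟨t, rfl, antitone_nat_of_succ_le fun k => ?_, hpos, fun k => ?_⟩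
  · rw [hsucc]; exact hgle _ (hpos k)
  · rw [hsucc]; exact hgr _ (hpos k)

/-- Let `(Xbar, d̄)` be a compact metric space, `Z ⊆ Xbar` closed,
`X = Xbar \ Z` (the subtype `↥Zᶜ`, whose inherited metric is `d̄`).  Let `d` be a metric
on `X` inducing the subspace topology and proper.  Assume the `Z`-set condition and the
control condition, and that the Gromov macroscopic dimension of `(X, d)` is at most `n`
(there is a uniformly `d`-bounded open cover of order at most `n + 1`).  Then for every
`ε > 0` there is an open cover `𝒱` of `Z × [0,1]` (with the sup-metric `d∞`, which is
the product metric in Mathlib) of mesh `< ε` and order at most `n + 1`. -/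
theorem dim_boundary_times_interval_of_controlled_Z_compactification
    {Xbar : Type*} [MetricSpace Xbar] [CompactSpace Xbar]
    (Z : Set Xbar) (hZclosed : IsClosed Z)
    -- `d` is a metric on `X = ↥Zᶜ`
    (d : ↥Zᶜ → ↥Zᶜ → ℝ)
    (d_self : ∀ x, d x x = 0)
    (d_eq_zero : ∀ x y, d x y = 0 → x = y)
    (d_symm : ∀ x y, d x y = d y x)
    (d_triangle : ∀ x y z, d x z ≤ d x y + d y z)
    -- `d` induces the subspace topology on `X`
    (d_induces : ∀ s : Set ↥Zᶜ, IsOpen s ↔ ∀ x ∈ s, ∃ ε > 0, {y | d x y < ε} ⊆ s)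
    -- `d` is proper: closed `d`-bounded sets are compact
    (d_proper : ∀ s : Set ↥Zᶜ, IsClosed s → (∃ R, ∀ x ∈ s, ∀ y ∈ s, d x y ≤ R) →
      IsCompact s)
    -- the Z-set condition
    (H : Xbar × Icc (0 : ℝ) 1 → Xbar)
    (H_cont : Continuous H)
    (H_zero : ∀ (x : Xbar) (t : Icc (0 : ℝ) 1), (t : ℝ) = 0 → H (x, t) = x)
    (H_off : ∀ (x : Xbar) (t : Icc (0 : ℝ) 1), 0 < (t : ℝ) → H (x, t) ∉ Z)
    -- the control condition
    (control : ∀ ε > (0 : ℝ), ∀ R > (0 : ℝ), ∃ K : Set ↥Zᶜ, IsCompact K ∧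
      ∀ x : ↥Zᶜ, {y | d x y < R} ∩ K = ∅ → Metric.diam {y | d x y < R} < ε)
    -- Gromov macroscopic dimension at most `n`
    (n : ℕ)
    (hmc : ∃ 𝒰 : Set (Set ↥Zᶜ), (∀ U ∈ 𝒰, IsOpen U) ∧ ⋃₀ 𝒰 = univ ∧
      (∃ D > (0 : ℝ), ∀ U ∈ 𝒰, ∀ x ∈ U, ∀ y ∈ U, d x y ≤ D) ∧
      (∀ x : ↥Zᶜ, {U | U ∈ 𝒰 ∧ x ∈ U}.Finite ∧ {U | U ∈ 𝒰 ∧ x ∈ U}.ncard ≤ n + 1)) :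
    ∀ ε > (0 : ℝ), ∃ 𝒱 : Set (Set (↥Z × ↥(Icc (0 : ℝ) 1))),
      (∀ V ∈ 𝒱, IsOpen V) ∧ ⋃₀ 𝒱 = univ ∧
      (∀ V ∈ 𝒱, Metric.diam V < ε) ∧
      (∀ p : ↥Z × ↥(Icc (0 : ℝ) 1),
        {V | V ∈ 𝒱 ∧ p ∈ V}.Finite ∧ {V | V ∈ 𝒱 ∧ p ∈ V}.ncard ≤ n + 1) := by
  intro ε hε
  obtain ⟨𝒰, hUopen, hUcov, ⟨D, hD, hUD⟩, hUord⟩ := hmc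
  rcases Z.eq_empty_or_nonempty with rfl | ⟨z₀, hz₀⟩
  · exact ⟨∅, by simp, Subsingleton.elim _ _, by simp, by simp⟩
  let x₀ : ↥Zᶜ := ⟨H (z₀, ⟨1, by simp⟩), H_off _ _ one_pos⟩
  have hball_open (x : ↥Zᶜ) (r : ℝ) : IsOpen {y | d x y < r} := by
    refine (d_induces _).2 fun y (hy : d x y < r) => ⟨r - d x y, sub_pos.2 hy, fun w hw => ?_⟩
    have := d_triangle x y w
    simp only [mem_ofPred_eq] at hw ⊢
    linarith
  have hball_compact (x : ↥Zᶜ) (r : ℝ) : IsCompact {y | d x y ≤ r} := by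
    refine d_proper _ ⟨?_⟩ ⟨r + r, fun y hy w hw => ?_⟩
    · refine (d_induces _).2 fun y (hy : ¬ d x y ≤ r) =>
        ⟨d x y - r, sub_pos.2 (not_le.1 hy), fun w hw => ?_⟩
      have := d_triangle x w y
      rw [d_symm w y] at this
      simp only [mem_ofPred_eq, mem_compl_iff, not_le] at hw ⊢
      linarith
    · have := d_triangle y x w
      rw [d_symm y x] at this
      simp only [mem_ofPred_eq] at hy hw
      linarith
  have hbounded (K : Set ↥Zᶜ) (hK : IsCompact K) : ∃ R : ℝ, ∀ y ∈ K, d x₀ y < R := by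
    obtain ⟨m, hm⟩ := hK.elim_directed_cover (fun m : ℕ => {y | d x₀ y < m})
      (fun m => hball_open x₀ m) (fun y _ => mem_iUnion.2 (exists_nat_gt (d x₀ y)))
      (Monotone.directed_le fun a b hab y (hy : d x₀ y < a) =>
        hy.trans_le (Nat.cast_le.2 hab))
    exact ⟨m, fun y hy => hm hy⟩
  have hnear {δ : ℝ} (hδ : 0 < δ) := exists_forall_dist_homotopy_lt H_cont H_zero hδ
  have hescape (R : ℝ) : ∃ t : ℝ, 0 < t ∧ t ≤ 1 ∧ ∀ z ∈ Z, ∀ (u : Icc (0 : ℝ) 1)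
      (hu : 0 < (u : ℝ)), (u : ℝ) ≤ t → R < d x₀ ⟨H (z, u), H_off z u hu⟩ := by
    have hC : IsCompact (Subtype.val '' {y | d x₀ y ≤ R}) :=
      (hball_compact x₀ R).image continuous_subtype_val
    obtain ⟨δ, hδ, hdis⟩ := hC.exists_thickening_subset_open hZclosed.isOpen_compl
      (by rintro _ ⟨y, -, rfl⟩; exact y.2)
    obtain ⟨t, ht, ht1, h⟩ := hnear hδ
    refine ⟨t, ht, ht1, fun z hz u hu hut => ?_⟩
    by_contra! hle
    refine hdis (mem_thickening_iff.2 ⟨_, mem_image_of_mem _ hle, ?_⟩) hz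
    rw [dist_comm]
    exact h z u hut
  have hbdd_away (t : ℝ) (ht : 0 < t) : ∃ R : ℝ, ∀ (z : Xbar) (u : Icc (0 : ℝ) 1)
      (hu : 0 < (u : ℝ)), t ≤ u → d x₀ ⟨H (z, u), H_off z u hu⟩ < R := by
    let S : Set (Xbar × Icc (0 : ℝ) 1) := {p | t ≤ (p.2 : ℝ)}
    have hS : IsCompact S :=
      (isClosed_le continuous_const (continuous_subtype_val.comp continuous_snd)).isCompact
    have hK : IsCompact ((Subtype.val : ↥Zᶜ → Xbar) ⁻¹' (H '' S)) := by
      rw [Subtype.isCompact_iff, Subtype.image_preimage_coe, inter_eq_self_of_subset_right]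
      · exact hS.image H_cont
      · rintro _ ⟨p, hp, rfl⟩
        exact H_off p.1 p.2 (ht.trans_le hp)
    obtain ⟨R, hR⟩ := hbounded _ hK
    exact ⟨R, fun z u hu htu => hR _ ⟨(z, u), htu, rfl⟩⟩
  obtain ⟨K, hK, hKdiam⟩ := control (ε / 4) (by positivity) (D + 1) (by positivity)
  obtain ⟨R₀, hR₀⟩ := hbounded K hK
  obtain ⟨a, ha, ha1, hnear_a⟩ := hnear (show 0 < ε / 8 by positivity)
  obtain ⟨b, hb, -, hesc_b⟩ := hescape (R₀ + (D + 1))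
  obtain ⟨t, ht0, ht_anti, ht_pos, ht_sep⟩ := exists_antitone_seq (t₀ := min a b)
    (r := fun t t' => ∀ z ∈ Z, ∀ z' ∈ Z, ∀ (u u' : Icc (0 : ℝ) 1) (hu : 0 < (u : ℝ))
      (hu' : 0 < (u' : ℝ)), t ≤ u → (u' : ℝ) ≤ t' →
      D < d ⟨H (z, u), H_off z u hu⟩ ⟨H (z', u'), H_off z' u' hu'⟩) (lt_min ha hb) (by
    intro t ht
    obtain ⟨R, hR⟩ := hbdd_away t ht
    obtain ⟨t', ht', -, hesc⟩ := hescape (R + D)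
    refine ⟨min t t', lt_min ht ht', min_le_left _ _, ?_⟩
    intro z hz z' hz' u u' hu hu' htu hut
    have h1 := hR z u hu htu
    have h2 := hesc z' hz' u' hu' (hut.trans (min_le_right _ _))
    have h3 := d_triangle x₀ ⟨H (z, u), H_off z u hu⟩ ⟨H (z', u'), H_off z' u' hu'⟩
    linarith)
  obtain ⟨N, hN⟩ := exists_nat_gt (4 / ε)
  have hNpos : (0 : ℝ) < N := (by positivity : 0 < 4 / ε).trans hN
  obtain ⟨τ, hτc, hτa, hτpos, hτle, hτt⟩ := exists_antitone_interpolation t ht_anti ht_pos N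
  rw [ht0] at hτle
  let u : Icc (0 : ℝ) 1 → Icc (0 : ℝ) 1 := fun s =>
    ⟨τ (N * s), (hτpos _).le, (hτle _).trans ((min_le_left _ _).trans ha1)⟩
  have hu (s : Icc (0 : ℝ) 1) : 0 < (u s : ℝ) := hτpos _
  let Φ : ↥Z × Icc (0 : ℝ) 1 → ↥Zᶜ := fun p => ⟨H (p.1, u p.2), H_off _ _ (hu p.2)⟩
  have hΦ : Continuous Φ := by
    refine Continuous.subtype_mk (H_cont.comp ((continuous_subtype_val.comp continuous_fst).prodMk
      (Continuous.subtype_mk (hτc.comp ?_) _))) _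
    fun_prop
  have hfst (p q : ↥Z × Icc (0 : ℝ) 1) (hpq : d (Φ p) (Φ q) ≤ D) :
      dist p.1 q.1 ≤ ε / 2 := by
    have hdisj : {y | d (Φ p) y < D + 1} ∩ K = ∅ := by
      refine eq_empty_of_forall_notMem fun y ⟨hy, hyK⟩ => ?_
      have h1 := hR₀ y hyK
      have h2 : R₀ + (D + 1) < d x₀ (Φ p) :=
        hesc_b p.1 p.1.2 (u p.2) (hu p.2) ((hτle _).trans (min_le_right _ _))
      have h3 := d_triangle x₀ y (Φ p)
      rw [d_symm y] at h3
      simp only [mem_ofPred_eq] at hy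
      linarith
    have hdiam : dist (Φ p) (Φ q) < ε / 4 :=
      (dist_le_diam_of_mem (s := {y | d (Φ p) y < D + 1}) (Bornology.IsBounded.all _)
        (by rw [mem_ofPred_eq, d_self]; positivity)
        (by rw [mem_ofPred_eq]; linarith)).trans_lt (hKdiam _ hdisj)
    have hΦnear (w : ↥Z × Icc (0 : ℝ) 1) : dist (Φ w : Xbar) w.1 < ε / 8 :=
      hnear_a w.1 (u w.2) ((hτle _).trans (min_le_left _ _))
    have h1 := hΦnear p
    have h2 := hΦnear q
    have h3 := dist_triangle4 (p.1 : Xbar) (Φ p) (Φ q) q.1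
    rw [dist_comm (p.1 : Xbar) (Φ p)] at h3
    rw [Subtype.dist_eq] at hdiam ⊢
    linarith
  have hlt (p q : ↥Z × Icc (0 : ℝ) 1) (hpq : d (Φ p) (Φ q) ≤ D) :
      (q.2 : ℝ) - p.2 ≤ ε / 2 := by
    by_contra! hgap
    have hgapN : 2 < N * (q.2 : ℝ) - N * p.2 := by
      rw [div_lt_iff₀ hε] at hN
      nlinarith
    set k := ⌈(N : ℝ) * p.2⌉₊
    have hk1 : (N : ℝ) * p.2 ≤ k := Nat.le_ceil _
    have hk2 : (k : ℝ) < N * p.2 + 1 := Nat.ceil_lt_add_one (mul_nonneg hNpos.le p.2.2.1)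
    have hqN : (N : ℝ) * q.2 ≤ N := mul_le_of_le_one_right hNpos.le q.2.2.2
    have hkN : k + 1 ≤ N := by
      have : (k : ℝ) + 1 ≤ N := by linarith
      exact_mod_cast this
    refine hpq.not_gt (ht_sep k p.1 p.1.2 q.1 q.1.2 (u p.2) (u q.2) (hu _) (hu _) ?_ ?_)
    · rw [← hτt k (by lia)]
      exact hτa hk1
    · rw [← hτt (k + 1) hkN]
      refine hτa ?_
      push_cast
      linarith
  refine ⟨(fun U => Φ ⁻¹' U) '' 𝒰, ?_, ?_, ?_, fun p => order_preimage_cover_le Φ p (hUord _)⟩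
  · rintro _ ⟨U, hU, rfl⟩
    exact (hUopen U hU).preimage hΦ
  · refine eq_univ_of_forall fun p => ?_
    obtain ⟨U, hU, hp⟩ := hUcov.ge (mem_univ (Φ p))
    exact ⟨_, ⟨U, hU, rfl⟩, hp⟩
  · rintro _ ⟨U, hU, rfl⟩
    refine (diam_le_of_forall_dist_le (half_pos hε).le fun p hp q hq => ?_).trans_lt
      (half_lt_self hε)
    have hpq := hUD U hU _ hp _ hq
    have hqp := hUD U hU _ hq _ hp
    rw [Prod.dist_eq]
    exact max_le (hfst p q hpq) (abs_sub_le_iff.2 ⟨hlt q p hqp, hlt p q hpq⟩)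
end

section
/- Let (X̄, d̄) be a compact metric space, Z ⊆ X̄ a closed subset, and X = X̄ \ Z. Let d be a metric on X which induces on X the subspace topology inherited from X̄ and is proper. Assume the Z-set condition holds, and suppose a group G acts on (X, d) by isometries, properly and cocompactly, and that the nullity condition holds. Suppose n ∈ ℕ is such that for every uniformly bounded open cover 𝒱 of (X, d) there is a uniformly bounded open cover 𝒰 of (X, d) of order at most n + 1 such that every element of 𝒱 is contained in some element of 𝒰 (i.e., the asymptotic dimension of (X, d) is at most n). Then for every ε > 0 there exists an open cover 𝒱 of Z × [0,1], with the metric d∞, such that mesh(𝒱) < ε and the order of 𝒱 is at most n + 1 (so the covering dimension of Z × [0,1] is at most n, and hence dim Z + 1 ≤ asdim X = asdim G). -/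
open Set Metric Pointwise

/-- Any antitone sequence agrees on `{0, …, N}` with a continuous antitone function on `ℝ`. -/
theorem exists_continuous_antitone_interpolation (t : ℕ → ℝ) (ht : Antitone t) (N : ℕ) :
    ∃ φ : ℝ → ℝ, Continuous φ ∧ Antitone φ ∧ ∀ k ≤ N, φ k = t k := by
  induction N with
  | zero =>
    refine ⟨fun _ => t 0, continuous_const, antitone_const, fun k hk => ?_⟩
    rw [Nat.le_zero.mp hk]
  | succ N ih =>
    obtain ⟨φ, hc, ha, hφ⟩ := ih
    have hd : 0 ≤ t N - t (N + 1) := sub_nonneg.mpr (ht N.le_succ)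
    refine ⟨fun s => φ (min s N) - (t N - t (N + 1)) * max 0 (s - N), by fun_prop,
      fun a b hab => ?_, fun k hk => ?_⟩
    · have h₁ : φ (min b N) ≤ φ (min a N) := ha (min_le_min_right _ hab)
      have h₂ : (t N - t (N + 1)) * max 0 (a - N) ≤ (t N - t (N + 1)) * max 0 (b - N) := by
        gcongr
      simp only
      linarith
    · rcases Nat.lt_or_eq_of_le hk with h | rfl
      · have hkN : k ≤ N := Nat.lt_succ_iff.mp h
        have hkN' : (k : ℝ) ≤ N := by exact_mod_cast hkN
        simp [min_eq_left hkN', max_eq_left (sub_nonpos.mpr hkN'), hφ k hkN]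
      · have h₁ : min (((N + 1 : ℕ) : ℝ)) N = N := min_eq_right (by push_cast; linarith)
        simp only [h₁, hφ N le_rfl]
        push_cast
        rw [add_sub_cancel_left, max_eq_right zero_le_one]
        ring

/-- Let `ρ y s` be bounded for `s` away from `0` and tend to infinity, uniformly in `y`, as
`s → 0`.  Then `[0, 1]` can be mapped to `(0, t₀]` in such a way that values of `ρ` at distance at
most `D` come from parameters at distance at most `δ`. -/
theorem exists_reparametrization {Y : Type*} (ρ : Y → Ioc (0 : ℝ) 1 → ℝ)
    (bdd : ∀ t, ∃ B, ∀ y s, t ≤ s → ρ y s ≤ B) (unbdd : ∀ M, ∃ t, ∀ y, ∀ s ≤ t, M < ρ y s)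
    (D : ℝ) {δ : ℝ} (hδ : 0 < δ) (t₀ : Ioc (0 : ℝ) 1) :
    ∃ φ : Icc (0 : ℝ) 1 → Ioc (0 : ℝ) 1, Continuous φ ∧ (∀ s, φ s ≤ t₀) ∧
      ∀ y y' s s', |ρ y (φ s) - ρ y' (φ s')| ≤ D → dist s s' ≤ δ := by
  choose b hb using bdd
  choose r hr using unbdd
  obtain ⟨t, t_zero, t_succ⟩ : ∃ t : ℕ → Ioc (0 : ℝ) 1, t 0 = t₀ ∧
      ∀ k, t (k + 1) = min (t k) (r (b (t k) + D)) :=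
    ⟨fun k => Nat.rec t₀ (fun _ u => min u (r (b u + D))) k, rfl, fun _ => rfl⟩
  have t_anti : Antitone t := antitone_nat_of_succ_le fun k => by
    rw [t_succ]; exact min_le_left _ _
  obtain ⟨N, hN⟩ := exists_nat_gt (2 / δ)
  have hN0 : (0 : ℝ) < N := (by positivity : 0 < 2 / δ).trans hN
  obtain ⟨φ, φ_cont, φ_anti, hφ⟩ :=
    exists_continuous_antitone_interpolation (fun k => (t k : ℝ))
      ((Subtype.mono_coe _).comp_antitone t_anti) N
  have φ_le (x : ℝ) (hx : 0 ≤ x) : φ x ≤ t₀ := by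
    have h := φ_anti hx
    have h0 := hφ 0 N.zero_le
    rw [Nat.cast_zero, t_zero] at h0
    exact h.trans_eq h0
  have φ_ge (x : ℝ) (hx : x ≤ N) : (t N : ℝ) ≤ φ x := by
    have h := φ_anti hx
    exact (hφ N le_rfl).symm.trans_le h
  have mem (s : Icc (0 : ℝ) 1) : φ (N * s) ∈ Ioc (0 : ℝ) 1 :=
    ⟨lt_of_lt_of_le (t N).2.1 (φ_ge _ (mul_le_of_le_one_right hN0.le s.2.2)),
      (φ_le _ (mul_nonneg hN0.le s.2.1)).trans t₀.2.2⟩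
  have key (y y' : Y) (s s' : Icc (0 : ℝ) 1) (h : (s : ℝ) + δ < s') :
      D < ρ y' ⟨φ (N * s'), mem s'⟩ - ρ y ⟨φ (N * s), mem s⟩ := by
    set i := ⌈(N : ℝ) * s⌉₊
    have hi : (N : ℝ) * s ≤ i := Nat.le_ceil _
    have hi' : (i : ℝ) < N * s + 1 := Nat.ceil_lt_add_one (mul_nonneg hN0.le s.2.1)
    have h2 : 2 < N * δ := (div_lt_iff₀ hδ).mp hN
    have h3 : N * ((s : ℝ) + δ) < N * s' := mul_lt_mul_of_pos_left h hN0
    have h4 : (N : ℝ) * s' ≤ N := mul_le_of_le_one_right hN0.le s'.2.2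
    have h5 : ((i + 1 : ℕ) : ℝ) ≤ N * s' := by push_cast; linarith
    have h6 : i + 1 ≤ N := by exact_mod_cast h5.trans h4
    have h7 : t i ≤ ⟨φ (N * s), mem s⟩ := by
      change (t i : ℝ) ≤ φ (N * s)
      rw [← hφ i (by omega)]
      exact φ_anti hi
    have h8 : (⟨φ (N * s'), mem s'⟩ : Ioc (0 : ℝ) 1) ≤ t (i + 1) := by
      change φ (N * s') ≤ (t (i + 1) : ℝ)
      rw [← hφ (i + 1) h6]
      exact φ_anti h5
    have h9 := hb _ y _ h7
    have h10 := hr _ y' _ (h8.trans ((t_succ i).trans_le (min_le_right _ _)))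
    linarith
  refine ⟨fun s => ⟨φ (N * s), mem s⟩, by fun_prop, fun s => φ_le _ (mul_nonneg hN0.le s.2.1),
    fun y y' s s' h => ?_⟩
  rw [abs_le] at h
  rw [Subtype.dist_eq, Real.dist_eq, abs_sub_le_iff]
  constructor
  · by_contra! hlt
    linarith [key y' y s' s (by linarith)]
  · by_contra! hlt
    linarith [key y y' s s' (by linarith)]

/-- Let `(Xbar, d̄)` be a compact metric space, `Z ⊆ Xbar` closed,
`X = Xbar \ Z` (the subtype `↥Zᶜ`).  Let `d` be a proper metric on `X` inducing the
subspace topology.  Assume the `Z`-set condition, and that a group `G` acts on `(X, d)`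
by isometries, properly and cocompactly, satisfying the nullity condition.  If the
asymptotic dimension of `(X, d)` is at most `n`, then for every `ε > 0` there is an
open cover `𝒱` of `Z × [0,1]` (with the sup-metric `d∞`, the product metric in
Mathlib) of mesh `< ε` and order at most `n + 1`. -/
theorem dim_boundary_times_interval_of_Z_structure
    {Xbar : Type*} [MetricSpace Xbar] [CompactSpace Xbar]
    (Z : Set Xbar) (hZclosed : IsClosed Z)
    -- `d` is a metric on `X = ↥Zᶜ`
    (d : ↥Zᶜ → ↥Zᶜ → ℝ)
    (d_self : ∀ x, d x x = 0)
    (d_eq_zero : ∀ x y, d x y = 0 → x = y)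
    (d_symm : ∀ x y, d x y = d y x)
    (d_triangle : ∀ x y z, d x z ≤ d x y + d y z)
    -- `d` induces the subspace topology on `X`
    (d_induces : ∀ s : Set ↥Zᶜ, IsOpen s ↔ ∀ x ∈ s, ∃ ε > 0, {y | d x y < ε} ⊆ s)
    -- `d` is proper: closed `d`-bounded sets are compact
    (d_proper : ∀ s : Set ↥Zᶜ, IsClosed s → (∃ R, ∀ x ∈ s, ∀ y ∈ s, d x y ≤ R) →
      IsCompact s)
    -- the Z-set condition
    (H : Xbar × Icc (0 : ℝ) 1 → Xbar)
    (H_cont : Continuous H)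
    (H_zero : ∀ (x : Xbar) (t : Icc (0 : ℝ) 1), (t : ℝ) = 0 → H (x, t) = x)
    (H_off : ∀ (x : Xbar) (t : Icc (0 : ℝ) 1), 0 < (t : ℝ) → H (x, t) ∉ Z)
    -- a group `G` acts on `X` by `d`-isometries
    (G : Type*) [Group G] [MulAction G ↥Zᶜ]
    (isom : ∀ (g : G) (x y : ↥Zᶜ), d (g • x) (g • y) = d x y)
    -- the action is proper
    (proper_action : ∀ C : Set ↥Zᶜ, IsCompact C →
      {g : G | ((g • C) ∩ C).Nonempty}.Finite)
    -- the action is cocompact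
    (cocompact : ∃ C : Set ↥Zᶜ, IsCompact C ∧ ∀ x : ↥Zᶜ, ∃ g : G, g • x ∈ C)
    -- the nullity condition
    (nullity : ∀ C : Set ↥Zᶜ, IsCompact C → ∀ 𝒰 : Set (Set Xbar),
      (∀ U ∈ 𝒰, IsOpen U) → ⋃₀ 𝒰 = univ →
      {g : G | ¬ ∃ U ∈ 𝒰, (Subtype.val '' (g • C) : Set Xbar) ⊆ U}.Finite)
    -- asymptotic dimension at most `n`
    (n : ℕ)
    (hasdim : ∀ 𝒱 : Set (Set ↥Zᶜ), (∀ V ∈ 𝒱, IsOpen V) → ⋃₀ 𝒱 = univ →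
      (∃ D > (0 : ℝ), ∀ V ∈ 𝒱, ∀ x ∈ V, ∀ y ∈ V, d x y ≤ D) →
      ∃ 𝒰 : Set (Set ↥Zᶜ), (∀ U ∈ 𝒰, IsOpen U) ∧ ⋃₀ 𝒰 = univ ∧
        (∃ D > (0 : ℝ), ∀ U ∈ 𝒰, ∀ x ∈ U, ∀ y ∈ U, d x y ≤ D) ∧
        (∀ x : ↥Zᶜ, {U | U ∈ 𝒰 ∧ x ∈ U}.Finite ∧ {U | U ∈ 𝒰 ∧ x ∈ U}.ncard ≤ n + 1) ∧
        (∀ V ∈ 𝒱, ∃ U ∈ 𝒰, V ⊆ U)) :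
    ∀ ε > (0 : ℝ), ∃ 𝒱 : Set (Set (↥Z × ↥(Icc (0 : ℝ) 1))),
      (∀ V ∈ 𝒱, IsOpen V) ∧ ⋃₀ 𝒱 = univ ∧
      (∀ V ∈ 𝒱, Metric.diam V < ε) ∧
      (∀ p : ↥Z × ↥(Icc (0 : ℝ) 1),
        {V | V ∈ 𝒱 ∧ p ∈ V}.Finite ∧ {V | V ∈ 𝒱 ∧ p ∈ V}.ncard ≤ n + 1) := by
  intro ε hε
  rcases isEmpty_or_nonempty Z with hZ | ⟨⟨z₀⟩⟩
  · exact ⟨∅, by simp, Subsingleton.elim _ _, by simp, by simp⟩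
  let e : Z × Ioc (0 : ℝ) 1 → ↥Zᶜ := fun p =>
    ⟨H (p.1, ⟨p.2, p.2.2.1.le, p.2.2.2⟩), H_off _ _ p.2.2.1⟩
  have e_cont : Continuous e := by
    refine Continuous.subtype_mk (H_cont.comp ?_) _
    fun_prop
  obtain ⟨C, hC, hGC⟩ := cocompact
  obtain ⟨c, -⟩ : C.Nonempty := (hGC (e (z₀, ⟨1, by simp⟩))).imp' _ fun _ => id
  have ball_open (x : ↥Zᶜ) (r : ℝ) : IsOpen {y | d x y < r} := by
    refine (d_induces _).2 fun y hy => ⟨r - d x y, sub_pos.2 hy, fun w hw => ?_⟩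
    have := d_triangle x y w
    simp only [mem_ofPred_eq] at *
    linarith
  have d_cont : Continuous (d c) := by
    refine Metric.continuous_iff'.2 fun x r hr => ?_
    filter_upwards [(ball_open x r).mem_nhds (by simpa [d_self] using hr)] with y hy
    rw [Real.dist_eq, abs_sub_lt_iff]
    have h₁ := d_triangle c x y
    have h₂ := d_triangle c y x
    rw [d_symm y x] at h₂
    change d x y < r at hy
    constructor <;> linarith
  have closedBall_compact (M : ℝ) : IsCompact {y | d c y ≤ M} := by
    refine d_proper _ (isClosed_le d_cont continuous_const) ⟨M + M, fun x hx y hy => ?_⟩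
    have := d_triangle x c y
    rw [d_symm x c] at this
    simp only [mem_ofPred_eq] at hx hy
    linarith
  -- a uniformly bounded open cover of small order
  obtain ⟨𝒰, 𝒰_open, 𝒰_cover, ⟨D, -, hD⟩, 𝒰_order, -⟩ :=
    hasdim (range fun x => {y | d x y < 1}) (by rintro _ ⟨x, rfl⟩; exact ball_open x 1)
      (eq_univ_of_forall fun x => ⟨_, ⟨x, rfl⟩, by simp [d_self]⟩)
      ⟨2, two_pos, by
        rintro _ ⟨x, rfl⟩ y hy w hw
        have := d_triangle y x w
        rw [d_symm y x] at this
        simp only [mem_ofPred_eq] at hy hw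
        linarith⟩
  -- `D`-close points far away from `c` are close in `Xbar`
  obtain ⟨M, hM⟩ : ∃ M, ∀ x y : ↥Zᶜ, d x y ≤ D → M < d c x →
      dist (x : Xbar) y ≤ ε / 6 := by
    obtain ⟨R, hR⟩ := (hC.image d_cont).bddAbove
    let C' : Set ↥Zᶜ := {y | d c y ≤ R + |D|}
    have hfin := nullity C' (closedBall_compact _) (range fun x => ball x (ε / 12))
      (by rintro _ ⟨x, rfl⟩; exact isOpen_ball)
      (eq_univ_of_forall fun x => ⟨_, ⟨x, rfl⟩, mem_ball_self (by positivity)⟩)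
    obtain ⟨B, hB⟩ := (hfin.image fun g => d c (g • c)).bddAbove
    refine ⟨B + (R + |D|), fun x y hxy hx => ?_⟩
    obtain ⟨g, hg⟩ := hGC x
    have hgx : d c (g • x) ≤ R := hR (mem_image_of_mem _ hg)
    have hgy : d c (g • y) ≤ R + |D| := by
      have := d_triangle c (g • x) (g • y)
      rw [isom] at this
      linarith [le_abs_self D]
    have hgx' : d c (g • x) ≤ R + |D| := by linarith [abs_nonneg D]
    have hgood : ∃ U ∈ range fun x : Xbar => ball x (ε / 12),
        (Subtype.val '' (g⁻¹ • C') : Set Xbar) ⊆ U := by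
      by_contra hbad
      have h₁ : d c (g⁻¹ • c) ≤ B := hB (mem_image_of_mem (fun g => d c (g • c)) hbad)
      have h₂ := d_triangle c (g⁻¹ • c) x
      rw [← isom g (g⁻¹ • c) x, smul_inv_smul] at h₂
      linarith
    obtain ⟨_, ⟨w, rfl⟩, hw⟩ := hgood
    have hxw := hw ⟨x, ⟨g • x, hgx', inv_smul_smul g x⟩, rfl⟩
    have hyw := hw ⟨y, ⟨g • y, hgy, inv_smul_smul g y⟩, rfl⟩
    have := dist_triangle_right (x : Xbar) y w
    rw [mem_ball] at hxw hyw
    linarith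
  -- `H` moves points little for small times
  have H_near (η : ℝ) (hη : 0 < η) : ∃ t : Ioc (0 : ℝ) 1, ∀ z : Z, ∀ s ≤ t,
      dist (e (z, s) : Xbar) z < η := by
    obtain ⟨r, hr, hH⟩ := Metric.uniformContinuous_iff.1
      (CompactSpace.uniformContinuous_of_continuous H_cont) η hη
    refine ⟨⟨min 1 (r / 2), by positivity, min_le_left _ _⟩, fun z s hs => ?_⟩
    have hs' : (s : ℝ) ≤ r / 2 := le_trans hs (min_le_right _ _)
    have h := hH (a := ((z : Xbar), ⟨s, s.2.1.le, s.2.2⟩)) (b := ((z : Xbar), ⟨0, by simp⟩)) (by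
      rw [Prod.dist_eq, dist_self, Subtype.dist_eq, Real.dist_eq, sub_zero, abs_of_pos s.2.1]
      exact max_lt hr (by linarith))
    rwa [H_zero z ⟨0, by simp⟩ rfl] at h
  have unbdd (K : ℝ) : ∃ t : Ioc (0 : ℝ) 1, ∀ z : Z, ∀ s ≤ t, K < d c (e (z, s)) := by
    have hK : IsClosed (Subtype.val '' {y | d c y ≤ K} : Set Xbar) :=
      ((closedBall_compact K).image continuous_subtype_val).isClosed
    obtain ⟨η, hη, hsub⟩ := hZclosed.isCompact.exists_thickening_subset_open hK.isOpen_compl (by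
      rintro z hz ⟨y, -, rfl⟩
      exact y.2 hz)
    obtain ⟨t, ht⟩ := H_near η hη
    refine ⟨t, fun z s hs => ?_⟩
    by_contra! hle
    exact hsub (mem_thickening_iff.2 ⟨z, z.2, ht z s hs⟩) ⟨_, hle, rfl⟩
  have bdd (t : Ioc (0 : ℝ) 1) : ∃ B, ∀ (z : Z) (s : Ioc (0 : ℝ) 1), t ≤ s →
      d c (e (z, s)) ≤ B := by
    have : CompactSpace Z := isCompact_iff_compactSpace.1 hZclosed.isCompact
    have ht : IsCompact (Subtype.val ⁻¹' Icc (t : ℝ) 1 : Set (Ioc (0 : ℝ) 1)) := by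
      refine (Topology.IsInducing.subtypeVal.isCompact_preimage_iff ?_).2 isCompact_Icc
      rw [Subtype.range_coe]
      exact fun s hs => ⟨t.2.1.trans_le hs.1, hs.2⟩
    obtain ⟨B, hB⟩ := ((isCompact_univ.prod ht).image (d_cont.comp e_cont)).bddAbove
    exact ⟨B, fun z s hs => hB ⟨(z, s), ⟨mem_univ _, hs, s.2.2⟩, rfl⟩⟩
  obtain ⟨t₁, ht₁⟩ := H_near (ε / 6) (by positivity)
  obtain ⟨t₂, ht₂⟩ := unbdd M
  obtain ⟨φ, φ_cont, φ_le, hφ⟩ := exists_reparametrization (fun z s => d c (e (z, s))) bdd unbdd D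
    (half_pos hε) (min t₁ t₂)
  let F : Z × Icc (0 : ℝ) 1 → ↥Zᶜ := fun p => e (p.1, φ p.2)
  have F_cont : Continuous F := by fun_prop
  refine ⟨(F ⁻¹' ·) '' 𝒰, ?_, ?_, ?_, fun p => ?_⟩
  · rintro _ ⟨U, hU, rfl⟩
    exact (𝒰_open U hU).preimage F_cont
  · refine eq_univ_of_forall fun p => ?_
    obtain ⟨U, hU, hp⟩ := 𝒰_cover.symm ▸ mem_univ (F p)
    exact ⟨_, ⟨U, hU, rfl⟩, hp⟩
  · rintro _ ⟨U, hU, rfl⟩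
    refine (diam_le_of_forall_dist_le (half_pos hε).le ?_).trans_lt (half_lt_self hε)
    rintro ⟨z, s⟩ hp ⟨z', s'⟩ hq
    have hpq : d (e (z, φ s)) (e (z', φ s')) ≤ D := hD U hU _ hp _ hq
    rw [Prod.dist_eq]
    refine max_le ?_ (hφ z z' s s' ?_)
    · have h₁ := ht₁ z _ ((φ_le s).trans (min_le_left _ _))
      have h₂ := ht₁ z' _ ((φ_le s').trans (min_le_left _ _))
      have h₃ := hM _ _ hpq (ht₂ z _ ((φ_le s).trans (min_le_right _ _)))
      have h₄ := dist_triangle4 (z : Xbar) (e (z, φ s)) (e (z', φ s')) z'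
      rw [dist_comm (z : Xbar) (e _)] at h₄
      change dist (z : Xbar) z' ≤ ε / 2
      linarith
    · have h₁ := d_triangle c (e (z, φ s)) (e (z', φ s'))
      have h₂ := d_triangle c (e (z', φ s')) (e (z, φ s))
      rw [d_symm (e (z', φ s'))] at h₂
      rw [abs_sub_le_iff]
      constructor <;> linarith
  · obtain ⟨hfin, hcard⟩ := 𝒰_order (F p)
    have heq : {V | V ∈ (F ⁻¹' ·) '' 𝒰 ∧ p ∈ V} = (F ⁻¹' ·) '' {U | U ∈ 𝒰 ∧ F p ∈ U} := by
      ext V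
      constructor
      · rintro ⟨⟨U, hU, rfl⟩, hp⟩
        exact ⟨U, ⟨hU, hp⟩, rfl⟩
      · rintro ⟨U, ⟨hU, hp⟩, rfl⟩
        exact ⟨⟨U, hU, rfl⟩, hp⟩
    rw [heq]
    exact ⟨hfin.image _, (ncard_image_le hfin).trans hcard⟩
end

section
/- Let (X, d) be a compact metric space and n ∈ ℕ. Then the following are equivalent: (1) every open cover of X has an open refinement of order at most n + 1; (2) for every ε > 0 there is an open cover 𝒰 of X with mesh(𝒰) < ε and order of 𝒰 at most n + 1. (Condition (1) says the covering dimension of X is at most n.) -/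
open Set Metric

/-- For a compact metric space `X` and `n : ℕ`, the following are
equivalent: (1) every open cover of `X` has an open refinement of order at most `n + 1`
(i.e. the covering dimension of `X` is at most `n`); (2) for every `ε > 0` there is an
open cover `𝒰` of `X` with mesh `< ε` and order at most `n + 1`. -/
theorem covering_dimension_le_iff_small_mesh_covers
    {X : Type*} [MetricSpace X] [CompactSpace X] (n : ℕ) :
    (∀ 𝒰 : Set (Set X), (∀ U ∈ 𝒰, IsOpen U) → ⋃₀ 𝒰 = univ →
      ∃ 𝒱 : Set (Set X), (∀ V ∈ 𝒱, IsOpen V) ∧ ⋃₀ 𝒱 = univ ∧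
        (∀ V ∈ 𝒱, ∃ U ∈ 𝒰, V ⊆ U) ∧
        (∀ x : X, {V | V ∈ 𝒱 ∧ x ∈ V}.Finite ∧ {V | V ∈ 𝒱 ∧ x ∈ V}.ncard ≤ n + 1)) ↔
    (∀ ε > (0 : ℝ), ∃ 𝒰 : Set (Set X), (∀ U ∈ 𝒰, IsOpen U) ∧ ⋃₀ 𝒰 = univ ∧
      (∀ U ∈ 𝒰, Metric.diam U < ε) ∧
      (∀ x : X, {U | U ∈ 𝒰 ∧ x ∈ U}.Finite ∧ {U | U ∈ 𝒰 ∧ x ∈ U}.ncard ≤ n + 1)) := by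
  constructor
  · intro h ε hε
    obtain ⟨𝒱, hopen, hcov, href, hord⟩ := h (range fun x : X => ball x (ε / 3))
      (by rintro _ ⟨x, rfl⟩; exact isOpen_ball)
      (eq_univ_of_forall fun x => ⟨_, ⟨x, rfl⟩, mem_ball_self (by positivity)⟩)
    refine ⟨𝒱, hopen, hcov, fun V hV => ?_, hord⟩
    obtain ⟨_, ⟨x, rfl⟩, hVx⟩ := href V hV
    have h₁ := diam_mono hVx isBounded_ball
    have h₂ := diam_ball (x := x) (r := ε / 3) (by positivity)
    linarith
  · intro h 𝒰 hopen hcov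
    obtain ⟨δ, hδ, hball⟩ :=
      lebesgue_number_lemma_of_metric_sUnion isCompact_univ hopen hcov.ge
    obtain ⟨𝒱, hVopen, hVcov, hdiam, hord⟩ := h δ hδ
    refine ⟨{V ∈ 𝒱 | V.Nonempty}, fun V hV => hVopen V hV.1, ?_, ?_, fun x => ?_⟩
    · refine eq_univ_of_forall fun x => ?_
      obtain ⟨V, hV, hx⟩ := hVcov.ge (mem_univ x)
      exact ⟨V, ⟨hV, x, hx⟩, hx⟩
    · rintro V ⟨hV, x, hx⟩
      obtain ⟨U, hU, hxU⟩ := hball x (mem_univ x)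
      exact ⟨U, hU, fun y hy => hxU
        ((dist_le_diam_of_mem isBounded_of_compactSpace hy hx).trans_lt (hdiam V hV))⟩
    · have hsub : {V | V ∈ {V ∈ 𝒱 | V.Nonempty} ∧ x ∈ V} ⊆ {V | V ∈ 𝒱 ∧ x ∈ V} :=
        fun V hV => ⟨hV.1.1, hV.2⟩
      exact ⟨(hord x).1.subset hsub, (ncard_le_ncard hsub (hord x).1).trans (hord x).2⟩
end

section
/- Let (X̄, d̄) be a compact metric space, Z ⊆ X̄ a closed subset, and X = X̄ \ Z. Let d be a metric on X which induces on X the subspace topology inherited from X̄ and is proper. Suppose a group G acts on (X, d) by isometries, the action is cocompact, and the nullity condition holds. Then the control condition holds: for every ε > 0 and R > 0 there is a compact set K ⊆ X such that every open d-ball of radius R in X that is disjoint from K has d̄-diameter less than ε. -/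
open Set Metric Pointwise

/-- Let `(Xbar, d̄)` be a compact metric space, `Z ⊆ Xbar` closed,
`X = Xbar \ Z` (the subtype `↥Zᶜ`, whose inherited metric is `d̄`), and `d` a proper
metric on `X` inducing the subspace topology.  If a group `G` acts on `(X, d)` by
isometries, cocompactly, and the nullity condition holds, then the control condition
holds: for all `ε > 0` and `R > 0` there is a compact `K ⊆ X` such that every open
`d`-ball of radius `R` disjoint from `K` has `d̄`-diameter less than `ε`. -/
theorem control_condition_of_Z_structure
    {Xbar : Type*} [MetricSpace Xbar] [CompactSpace Xbar]
    (Z : Set Xbar) (hZclosed : IsClosed Z)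
    -- `d` is a metric on `X = ↥Zᶜ`
    (d : ↥Zᶜ → ↥Zᶜ → ℝ)
    (d_self : ∀ x, d x x = 0)
    (d_eq_zero : ∀ x y, d x y = 0 → x = y)
    (d_symm : ∀ x y, d x y = d y x)
    (d_triangle : ∀ x y z, d x z ≤ d x y + d y z)
    -- `d` induces the subspace topology on `X`
    (d_induces : ∀ s : Set ↥Zᶜ, IsOpen s ↔ ∀ x ∈ s, ∃ ε > 0, {y | d x y < ε} ⊆ s)
    -- `d` is proper: closed `d`-bounded sets are compact
    (d_proper : ∀ s : Set ↥Zᶜ, IsClosed s → (∃ R, ∀ x ∈ s, ∀ y ∈ s, d x y ≤ R) →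
      IsCompact s)
    -- a group `G` acts on `X` by `d`-isometries
    (G : Type*) [Group G] [MulAction G ↥Zᶜ]
    (isom : ∀ (g : G) (x y : ↥Zᶜ), d (g • x) (g • y) = d x y)
    -- the action is cocompact
    (cocompact : ∃ C : Set ↥Zᶜ, IsCompact C ∧ ∀ x : ↥Zᶜ, ∃ g : G, g • x ∈ C)
    -- the nullity condition
    (nullity : ∀ C : Set ↥Zᶜ, IsCompact C → ∀ 𝒰 : Set (Set Xbar),
      (∀ U ∈ 𝒰, IsOpen U) → ⋃₀ 𝒰 = univ →
      {g : G | ¬ ∃ U ∈ 𝒰, (Subtype.val '' (g • C) : Set Xbar) ⊆ U}.Finite) :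
    ∀ ε > (0 : ℝ), ∀ R > (0 : ℝ), ∃ K : Set ↥Zᶜ, IsCompact K ∧
      ∀ x : ↥Zᶜ, {y | d x y < R} ∩ K = ∅ → Metric.diam {y | d x y < R} < ε := by
  have isOpen_ball : ∀ (c : ↥Zᶜ) (r : ℝ), IsOpen {y | d c y < r} := by
    refine fun c r => (d_induces _).2 fun x hx => ⟨r - d c x, sub_pos.2 hx, fun y hy => ?_⟩
    simp only [mem_ofPred_eq] at hx hy ⊢
    linarith [d_triangle c x y]
  have isCompact_closedBall : ∀ (c : ↥Zᶜ) (r : ℝ), IsCompact {y | d c y ≤ r} := by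
    refine fun c r => d_proper _ ?_ ⟨r + r, fun x hx y hy => ?_⟩
    · refine isOpen_compl_iff.1 ((d_induces _).2 fun x hx => ?_)
      simp only [mem_compl_iff, mem_ofPred_eq, not_le] at hx
      refine ⟨d c x - r, sub_pos.2 hx, fun y hy => ?_⟩
      simp only [mem_compl_iff, mem_ofPred_eq, not_le] at hy ⊢
      linarith [d_triangle c y x, d_symm x y]
    · simp only [mem_ofPred_eq] at hx hy
      linarith [d_triangle x c y, d_symm x c]
  intro ε hε R hR
  obtain ⟨C, hC, hcover⟩ := cocompact
  rcases isEmpty_or_nonempty ↥Zᶜ with hX | ⟨⟨c⟩⟩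
  · exact ⟨∅, isCompact_empty, fun x => isEmptyElim x⟩
  obtain ⟨n, hn⟩ : ∃ n : ℕ, C ⊆ {y | d c y < n} := by
    refine hC.elim_directed_cover (fun n : ℕ => {y | d c y < n}) (fun n => isOpen_ball c n)
      (fun y _ => mem_iUnion.2 (exists_nat_gt (d c y))) (Monotone.directed_le ?_)
    exact fun m n hmn y (hy : d c y < m) => hy.trans_le (Nat.cast_le.2 hmn)
  have hbad := nullity {y | d c y ≤ n + R} (isCompact_closedBall c _)
    (range fun p : Xbar => ball p (ε / 3)) (by rintro _ ⟨p, rfl⟩; exact Metric.isOpen_ball)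
    (eq_univ_of_forall fun p => ⟨_, ⟨p, rfl⟩, mem_ball_self (by positivity)⟩)
  refine ⟨_, hbad.isCompact_biUnion fun g _ => isCompact_closedBall (g • c) (n + R),
    fun x hx => ?_⟩
  obtain ⟨g, hg⟩ := hcover x
  have hball : ∀ y, d x y < R → d c (g • y) ≤ n + R := fun y hy => by
    have hgx : d c (g • x) < n := hn hg
    linarith [d_triangle c (g • x) (g • y), isom g x y]
  have hgood : ∃ U ∈ range fun p : Xbar => ball p (ε / 3),
      (Subtype.val '' (g⁻¹ • {y | d c y ≤ n + R}) : Set Xbar) ⊆ U := by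
    by_contra h
    have hxx : d x x < R := by rwa [d_self]
    refine eq_empty_iff_forall_notMem.1 hx x ⟨hxx, mem_biUnion (mem_ofPred.2 h) ?_⟩
    have := isom g (g⁻¹ • c) x
    rw [smul_inv_smul] at this
    exact this.symm.trans_le (hball x hxx)
  obtain ⟨_, ⟨p, rfl⟩, hU⟩ := hgood
  have hsub : ∀ y, d x y < R → dist (y : Xbar) p < ε / 3 := fun y hy =>
    hU ⟨y, ⟨g • y, hball y hy, inv_smul_smul g y⟩, rfl⟩
  refine (diam_le_of_forall_dist_le (C := 2 * (ε / 3)) (by positivity)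
    fun y hy z hz => ?_).trans_lt (by linarith)
  rw [Subtype.dist_eq]
  linarith [dist_triangle_right (y : Xbar) z p, hsub y hy, hsub z hz]
end
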